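/- Let T be a π-totally-convex set in a CAT(1) space M, and let N be the set of points at distance ≤ ρ from T, where ρ < π/2, equipped with its induced intrinsic (length) metric. Then N is a subset of extrinsic curvature ≤ tan ρ in M; that is, for pairs of points of N with sufficiently small intrinsic distance s and extrinsic distance r, s − r ≤ ((tan ρ)²/24)·r³ + o(r³) uniformly. -/

import Mathlib

open Set Metric Filter Topology
open scoped ENNReal NNReal

noncomputable section

/-- Inverse hyperbolic cosine. -/
def arcosh (x : ℝ) : ℝ := Real.log (x + Real.sqrt (x ^ 2 - 1))

/-- `g` restricted to `[a,b]` is a unit-speed geodesic, i.e. an isometric embedding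
of the interval `[a,b]`. -/
def IsUnitGeodesicOn {X : Type*} [MetricSpace X] (g : ℝ → X) (a b : ℝ) : Prop :=
  ∀ s ∈ Set.Icc a b, ∀ t ∈ Set.Icc a b, dist (g s) (g t) = |s - t|

/-- `x` and `y` are joined by a geodesic. -/
def JoinedByGeodesic {X : Type*} [MetricSpace X] (x y : X) : Prop :=
  ∃ g : ℝ → X, IsUnitGeodesicOn g 0 (dist x y) ∧ g 0 = x ∧ g (dist x y) = y

/-- Cosine of the angle of a triangle in the model surface `S_K` at the vertex between
sides of lengths `a` and `b`, with opposite side of length `c` (law of cosines in `S_K`). -/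
def modelCosAngle (K a b c : ℝ) : ℝ :=
  if 0 < K then
    (Real.cos (Real.sqrt K * c) - Real.cos (Real.sqrt K * a) * Real.cos (Real.sqrt K * b)) /
      (Real.sin (Real.sqrt K * a) * Real.sin (Real.sqrt K * b))
  else if K < 0 then
    (Real.cosh (Real.sqrt (-K) * a) * Real.cosh (Real.sqrt (-K) * b) -
        Real.cosh (Real.sqrt (-K) * c)) /
      (Real.sinh (Real.sqrt (-K) * a) * Real.sinh (Real.sqrt (-K) * b))
  else (a ^ 2 + b ^ 2 - c ^ 2) / (2 * a * b)

/-- Length of the side of a triangle in the model surface `S_K` opposite a vertex whose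
angle has cosine `co`, the two adjacent sides having lengths `a`, `b`
(law of cosines in `S_K`). -/
def modelDistOfAngle (K a b co : ℝ) : ℝ :=
  if 0 < K then
    Real.arccos (Real.cos (Real.sqrt K * a) * Real.cos (Real.sqrt K * b) +
      Real.sin (Real.sqrt K * a) * Real.sin (Real.sqrt K * b) * co) / Real.sqrt K
  else if K < 0 then
    arcosh (Real.cosh (Real.sqrt (-K) * a) * Real.cosh (Real.sqrt (-K) * b) -
      Real.sinh (Real.sqrt (-K) * a) * Real.sinh (Real.sqrt (-K) * b) * co) / Real.sqrt (-K)
  else Real.sqrt (a ^ 2 + b ^ 2 - 2 * a * b * co)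

/-- Distance in `S_K` from the comparison point `p̃` to the point at arclength `t` along
the side `q̃ r̃` of the comparison triangle for a triangle with `d(p,q) = pq`,
`d(p,r) = pr`, `d(q,r) = qr`. -/
def modelSideDist (K pq pr qr t : ℝ) : ℝ :=
  modelDistOfAngle K pq t (modelCosAngle K pq qr pr)

/-- Distance in the model surface `S_K` between the two points with Fermi coordinates
`z = (u₁, d₁)` and `w = (u₂, d₂)` (base parameter along a fixed geodesic, and distance
to that geodesic, both points on the same side). -/
def modelFermiDist (K : ℝ) (z w : ℝ × ℝ) : ℝ :=
  if 0 < K then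
    Real.arccos (Real.cos (Real.sqrt K * z.2) * Real.cos (Real.sqrt K * w.2) *
        Real.cos (Real.sqrt K * (z.1 - w.1)) +
      Real.sin (Real.sqrt K * z.2) * Real.sin (Real.sqrt K * w.2)) / Real.sqrt K
  else if K < 0 then
    arcosh (Real.cosh (Real.sqrt (-K) * z.2) * Real.cosh (Real.sqrt (-K) * w.2) *
        Real.cosh (Real.sqrt (-K) * (z.1 - w.1)) -
      Real.sinh (Real.sqrt (-K) * z.2) * Real.sinh (Real.sqrt (-K) * w.2)) / Real.sqrt (-K)
  else Real.sqrt ((z.1 - w.1) ^ 2 + (z.2 - w.2) ^ 2)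

/-- `X` is a CAT(K) space: a complete metric space in which any two points at distance
`< π/√K` are joined by a geodesic (no restriction when `K ≤ 0`), and for every geodesic
triangle of perimeter `< 2π/√K` the distance from a vertex to a point on the opposite
side is at most the corresponding distance in the comparison triangle in `S_K`
(the standard, equivalent, vertex–side form of the comparison). -/
def CatK (K : ℝ) (X : Type*) [MetricSpace X] : Prop :=
  CompleteSpace X ∧
    (∀ x y : X, (0 < K → dist x y < Real.pi / Real.sqrt K) → JoinedByGeodesic x y) ∧
    ∀ (p q r : X) (g : ℝ → X), IsUnitGeodesicOn g 0 (dist q r) → g 0 = q →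
      g (dist q r) = r →
      (0 < K → dist p q + dist q r + dist r p < 2 * Real.pi / Real.sqrt K) →
      ∀ t ∈ Set.Icc 0 (dist q r),
        dist p (g t) ≤ modelSideDist K (dist p q) (dist p r) (dist q r) t

/-- A set is (geodesically) convex if it contains every geodesic joining two of its
points. -/
def GeodesicConvex {X : Type*} [MetricSpace X] (S : Set X) : Prop :=
  ∀ x ∈ S, ∀ y ∈ S, ∀ g : ℝ → X, IsUnitGeodesicOn g 0 (dist x y) → g 0 = x →
    g (dist x y) = y → ∀ t ∈ Set.Icc 0 (dist x y), g t ∈ S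

/-- `X` has curvature bounded above (CBA) by `K`: every point has a convex neighborhood
which (with the induced metric) is a CAT(K) space. -/
def CurvBoundedAbove (K : ℝ) (X : Type*) [MetricSpace X] : Prop :=
  ∀ x : X, ∃ S : Set X, S ∈ nhds x ∧ GeodesicConvex S ∧ CatK K S

/-- `F` preserves the lengths of curves. -/
def LengthPreserving {N M : Type*} [MetricSpace N] [MetricSpace M] (F : N → M) : Prop :=
  ∀ (γ : ℝ → N) (s : Set ℝ), eVariationOn (F ∘ γ) s = eVariationOn γ s

/-- `X` is an intrinsic (length) metric space: the distance between two points is the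
infimum of lengths of curves joining them. -/
def IsLengthSpace (X : Type*) [MetricSpace X] : Prop :=
  ∀ x y : X, edist x y =
    ⨅ (γ : ℝ → X) (_ : ContinuousOn γ (Set.Icc 0 1) ∧ γ 0 = x ∧ γ 1 = y),
      eVariationOn γ (Set.Icc 0 1)

/-- `N` is a subspace of extrinsic curvature `≤ A` in `M`, via the length-preserving map
`F : N → M`:  `N` is a complete length space and the intrinsic distance `s = d_N` and the
extrinsic distance `r = d_M(F·,F·)` satisfy `s - r ≤ (A²/24) r³ + o(r³)`, uniformly over
all pairs of points with `s` sufficiently small. -/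
def SubspaceExtCurvLE {N M : Type*} [MetricSpace N] [MetricSpace M] (A : ℝ)
    (F : N → M) : Prop :=
  CompleteSpace N ∧ IsLengthSpace N ∧ LengthPreserving F ∧
    ∀ ε > 0, ∃ δ > 0, ∀ x y : N, dist x y < δ →
      dist x y - dist (F x) (F y) ≤
        A ^ 2 / 24 * dist (F x) (F y) ^ 3 + ε * dist (F x) (F y) ^ 3

/-- The induced intrinsic (pseudo)distance on a subset `S` of `M`: the infimum of lengths
of curves in `S` joining the two points. -/
def setIntrinsicEDist {X : Type*} [MetricSpace X] (S : Set X) (x y : X) : ℝ≥0∞ :=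
  ⨅ (γ : ℝ → X) (_ : ContinuousOn γ (Set.Icc 0 1) ∧ Set.MapsTo γ (Set.Icc 0 1) S ∧
      γ 0 = x ∧ γ 1 = y),
    eVariationOn γ (Set.Icc 0 1)

/-- A subset `N` of `M` (with its induced intrinsic metric, assumed complete) has
extrinsic curvature `≤ k` in `M`: the intrinsic distance `s` and extrinsic distance `r`
satisfy `s - r ≤ (k²/24) r³ + o(r³)`, uniformly over pairs with `s` sufficiently small. -/
def SetExtrinsicCurvLE {X : Type*} [MetricSpace X] (k : ℝ) (N : Set X) : Prop :=
  IsComplete N ∧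
    ∀ ε > 0, ∃ δ > 0, ∀ x ∈ N, ∀ y ∈ N, setIntrinsicEDist N x y < ENNReal.ofReal δ →
      (setIntrinsicEDist N x y).toReal - dist x y ≤
        k ^ 2 / 24 * dist x y ^ 3 + ε * dist x y ^ 3

/-- `T` is `π`-totally-convex: it contains every geodesic of length `< π` joining pairs
of its points. -/
def PiTotallyConvex {X : Type*} [MetricSpace X] (T : Set X) : Prop :=
  ∀ (g : ℝ → X) (L : ℝ), 0 ≤ L → L < Real.pi → IsUnitGeodesicOn g 0 L →
    g 0 ∈ T → g L ∈ T → ∀ t ∈ Set.Icc 0 L, g t ∈ T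

/-- The defining property of the injectivity radius at `p`, for the radius `ρ`:
for every `ε > 0` there is `δ > 0` such that any two Lipschitz curves from `p` to a
common point `q ∈ B(p,ρ)`, parametrized proportionally to arclength by `[0,1]`, whose
lengths are within `δ` of `d(p,q)`, are `ε`-close in the uniform distance. -/
def InjPropAt {X : Type*} [MetricSpace X] (p : X) (ρ : ℝ) : Prop :=
  ∀ ε > 0, ∃ δ > 0, ∀ q : X, dist p q < ρ →
    ∀ (γ₁ γ₂ : ℝ → X) (L₁ L₂ : ℝ≥0),
      HasConstantSpeedOnWith γ₁ (Set.Icc 0 1) L₁ → γ₁ 0 = p → γ₁ 1 = q →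
        |(L₁ : ℝ) - dist p q| < δ →
      HasConstantSpeedOnWith γ₂ (Set.Icc 0 1) L₂ → γ₂ 0 = p → γ₂ 1 = q →
        |(L₂ : ℝ) - dist p q| < δ →
      ∀ t ∈ Set.Icc (0 : ℝ) 1, dist (γ₁ t) (γ₂ t) ≤ ε

/-- The injectivity radius at `p`. -/
def injRadAt {X : Type*} [MetricSpace X] (p : X) : ℝ≥0∞ :=
  ⨆ (ρ : ℝ) (_ : InjPropAt p ρ), ENNReal.ofReal ρ

/-- The injectivity radius of `X`. -/
def injRad (X : Type*) [MetricSpace X] : ℝ≥0∞ := ⨅ p : X, injRadAt p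

/-- `π/√K`, with the convention that it is `∞` for `K ≤ 0`. -/
def piOverSqrt (K : ℝ) : ℝ≥0∞ :=
  if 0 < K then ENNReal.ofReal (Real.pi / Real.sqrt K) else ⊤

/-- `c(A,K)`: the circumference of a circle of (constant geodesic) curvature `A` in the
model surface `S_K`.  Such a circle exists iff `A² + K > 0`, in which case its
circumference is `2π/√(A² + K)`; otherwise (the complete `A`-curve being a line,
horocycle or equidistant) the value is `∞` by convention. -/
def modelCircumference (A K : ℝ) : ℝ≥0∞ :=
  if 0 < A ^ 2 + K then ENNReal.ofReal (2 * Real.pi / Real.sqrt (A ^ 2 + K)) else ⊤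

/-- The Euclidean comparison angle at `p` subtended by `x`, `y`. -/
def comparisonAngle {X : Type*} [MetricSpace X] (p x y : X) : ℝ :=
  Real.arccos ((dist p x ^ 2 + dist p y ^ 2 - dist x y ^ 2) / (2 * dist p x * dist p y))

/-- The Alexandrov upper angle between the curves `α` and `β` issuing from the common
point `α 0 = β 0`. -/
def upperAngle {X : Type*} [MetricSpace X] (α β : ℝ → X) : ℝ :=
  Filter.limsup (fun st : ℝ × ℝ => comparisonAngle (α 0) (α st.1) (β st.2))
    ((nhdsWithin (0 : ℝ) (Set.Ioi 0)) ×ˢ (nhdsWithin (0 : ℝ) (Set.Ioi 0)))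

/-- A continuous function `f` on `s` is `K`-convex if `f'' ≥ -K f` in the barrier sense:
at every interior point and for every `ε > 0` there is a `C²` lower support function `g`
with `g'' (x) ≥ -K f(x) - ε`. -/
def IsKConvexOn (K : ℝ) (s : Set ℝ) (f : ℝ → ℝ) : Prop :=
  ContinuousOn f s ∧
    ∀ x ∈ interior s, ∀ ε > 0, ∃ (g : ℝ → ℝ) (δ : ℝ), 0 < δ ∧
      Set.Ioo (x - δ) (x + δ) ⊆ s ∧
      ContDiffOn ℝ 2 g (Set.Ioo (x - δ) (x + δ)) ∧ g x = f x ∧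
      (∀ y ∈ Set.Ioo (x - δ) (x + δ), g y ≤ f y) ∧
      -K * f x - ε ≤ deriv (deriv g) x

/-- `γ` is parametrized by arclength on `[a,b]`. -/
def IsArclengthParamOn {X : Type*} [MetricSpace X] (γ : ℝ → X) (a b : ℝ) : Prop :=
  ∀ s t, a ≤ s → s ≤ t → t ≤ b → eVariationOn γ (Set.Icc s t) = ENNReal.ofReal (t - s)

/-- `γ` (parametrized by arclength on `[0,Λ]`) is a curve of extrinsic curvature `≤ k`:
for subarcs, arclength `s` and chordlength `r` satisfy `s - r ≤ (k²/24) s³ + o(s³)`. -/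
def CurveExtCurvLE {X : Type*} [MetricSpace X] (γ : ℝ → X) (Λ k : ℝ) : Prop :=
  IsArclengthParamOn γ 0 Λ ∧
    ∀ ε > 0, ∃ δ > 0, ∀ s t, 0 ≤ s → s ≤ t → t ≤ Λ → t - s < δ →
      (t - s) - dist (γ s) (γ t) ≤ k ^ 2 / 24 * (t - s) ^ 3 + ε * (t - s) ^ 3

/-- The quadrilateral region in `S_K` (in Fermi coordinates) with top vertices `zp`, `zq`
and bottom vertices their feet on the base geodesic: points over the base segment lying
on or below some geodesic joining `zp` to `zq`. -/
def fermiQuadRegion (K : ℝ) (zp zq : ℝ × ℝ) : Set (ℝ × ℝ) :=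
  {z | min zp.1 zq.1 ≤ z.1 ∧ z.1 ≤ max zp.1 zq.1 ∧ 0 ≤ z.2 ∧
    ∃ d', z.2 ≤ d' ∧
      modelFermiDist K zp (z.1, d') + modelFermiDist K (z.1, d') zq =
        modelFermiDist K zp zq}

theorem cat_cos {M : Type*} [MetricSpace M] (hM : CatK 1 M) (p q r : M) (g : ℝ → M)
    (hg : IsUnitGeodesicOn g 0 (dist q r)) (h0 : g 0 = q) (h1 : g (dist q r) = r)
    (hper : dist p q + dist q r + dist r p < 2 * Real.pi)
    (t : ℝ) (ht : t ∈ Set.Icc 0 (dist q r)) :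
    Real.sin (dist q r - t) * Real.cos (dist p q) + Real.sin t * Real.cos (dist p r) ≤
      Real.sin (dist q r) * Real.cos (dist p (g t)) := by
  have key := hM.2.2 p q r g hg h0 h1 (by intro _; simpa using hper) t ht
  obtain ⟨ht0, htL⟩ := ht
  have tri1 := dist_triangle p q r
  have tri2 := dist_triangle q r p
  have tri3 := dist_triangle q p r
  rw [dist_comm r p] at *
  rw [dist_comm q p] at tri2 tri3
  simp only [modelSideDist, modelDistOfAngle, modelCosAngle, zero_lt_one, if_true,
    Real.sqrt_one, one_mul, div_one] at key
  have e0 : dist p (g t) = dist p (g t) := rfl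
  generalize hL : dist q r = L at *
  generalize ha : dist p q = a at *
  generalize hc : dist p r = c at *
  have hL0 : 0 ≤ L := hL ▸ dist_nonneg
  have ha0 : 0 ≤ a := ha ▸ dist_nonneg
  have hc0 : 0 ≤ c := hc ▸ dist_nonneg
  have haπ : a < Real.pi := by linarith
  have hLπ : L < Real.pi := by linarith
  rcases hL0.eq_or_lt with hL' | hL'
  · have : t = 0 := by linarith
    subst this; simp [← hL']
  rcases ha0.eq_or_lt with ha' | ha'
  · have hpq : p = q := by rw [← dist_eq_zero, ha, ← ha']
    have hcL : c = L := by rw [← hc, ← hL, hpq]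
    have hd : dist p (g t) = t := by
      rw [hpq, ← h0, hg 0 ⟨le_rfl, hL0⟩ t ⟨ht0, htL⟩, zero_sub, abs_neg, abs_of_nonneg ht0]
    rw [hd, hcL, ← ha', Real.sin_sub, Real.cos_zero]
    linarith
  have sa : 0 < Real.sin a := Real.sin_pos_of_pos_of_lt_pi ha' haπ
  have sL : 0 < Real.sin L := Real.sin_pos_of_pos_of_lt_pi hL' hLπ
  have st : 0 ≤ Real.sin t := Real.sin_nonneg_of_nonneg_of_le_pi ht0 (by linarith)
  set y := Real.cos a * Real.cos t + Real.sin a * Real.sin t *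
    ((Real.cos c - Real.cos a * Real.cos L) / (Real.sin a * Real.sin L)) with hy
  have hyL : Real.sin L * y = Real.sin (L - t) * Real.cos a + Real.sin t * Real.cos c := by
    rw [hy, Real.sin_sub]; field_simp; ring
  have hcc : Real.cos c ≤ Real.cos (a - L) := by
    rw [← Real.cos_abs (a - L)]
    apply Real.cos_le_cos_of_nonneg_of_le_pi (abs_nonneg _) (by linarith)
    rw [abs_le]; constructor <;> linarith
  have hy1 : y ≤ 1 := by
    have h2 : Real.sin L * y ≤ Real.sin L * Real.cos (a - t) := by
      rw [hyL]
      calc _ ≤ Real.sin (L - t) * Real.cos a + Real.sin t * Real.cos (a - L) := by gcongr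
        _ = _ := by
          rw [Real.sin_sub, Real.cos_sub, Real.cos_sub]
          ring
    have := le_of_mul_le_mul_left h2 sL
    linarith [Real.cos_le_one (a - t)]
  rw [← hyL]
  apply mul_le_mul_of_nonneg_left _ sL.le
  have h3 : Real.cos (Real.arccos y) ≤ Real.cos (dist p (g t)) :=
    Real.cos_le_cos_of_nonneg_of_le_pi dist_nonneg (Real.arccos_le_pi y) key
  rcases le_total (-1) y with h4 | h4
  · rwa [Real.cos_arccos h4 hy1] at h3
  · linarith [Real.neg_one_le_cos (dist p (g t))]

theorem cat_joined {M : Type*} [MetricSpace M] (hM : CatK 1 M) (x y : M)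
    (h : dist x y < Real.pi) : JoinedByGeodesic x y :=
  hM.2.1 x y (by intro _; simpa using h)

/-- spherical quadrilateral inequality -/
theorem quad_ineq {M : Type*} [MetricSpace M] (hM : CatK 1 M) (x p p' x' : M)
    (hf : dist x p < Real.pi / 2) (hf' : dist x' p' < Real.pi / 2)
    (hD : dist x p' < Real.pi / 2) (hD' : dist x' p < Real.pi / 2)
    (hD0 : 0 < dist x p') (μ ν σ τ : ℝ) (hμ : 0 ≤ μ) (hν : 0 ≤ ν) (hσ : 0 < σ) (hτ : 0 ≤ τ) :
    2 * (σ * μ * Real.cos (dist x p) + σ * ν * Real.cos (dist x x') +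
      τ * μ * Real.cos (dist p p') + τ * ν * Real.cos (dist x' p')) ≤
    μ ^ 2 + ν ^ 2 + 2 * μ * ν * Real.cos (dist x' p) +
    (σ ^ 2 + τ ^ 2 + 2 * σ * τ * Real.cos (dist x p')) := by
  have hpi := Real.pi_pos
  obtain ⟨g, hg, g0, g1⟩ := cat_joined hM x p' (by linarith)
  set D := dist x p' with hDdef
  have sD : 0 < Real.sin D := Real.sin_pos_of_pos_of_lt_pi hD0 (by linarith)
  obtain ⟨t, ⟨ht0, htD⟩, ht⟩ : ∃ t ∈ Set.Icc 0 D, τ * Real.sin (D - t) - σ * Real.sin t = 0 := by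
    have hc : ContinuousOn (fun t => τ * Real.sin (D - t) - σ * Real.sin t) (Set.Icc 0 D) := by
      fun_prop
    have := intermediate_value_Icc' hD0.le hc
    apply this
    constructor
    · simp; positivity
    · simp; positivity
  have st : 0 ≤ Real.sin t := Real.sin_nonneg_of_nonneg_of_le_pi ht0 (by linarith)
  have sDt : 0 ≤ Real.sin (D - t) :=
    Real.sin_nonneg_of_nonneg_of_le_pi (by linarith) (by linarith)
  have sDt' : 0 < Real.sin (D - t) := by
    rcases (sub_nonneg.2 htD).eq_or_lt with h | h
    · exfalso
      rw [← h] at ht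
      have : t = D := by linarith
      rw [this] at ht; simp at ht
      rcases ht with h | h <;> linarith
    · exact Real.sin_pos_of_pos_of_lt_pi h (by linarith)
  set κ := σ / Real.sin (D - t) with hκ
  have hκ0 : 0 < κ := by positivity
  have e1 : σ = κ * Real.sin (D - t) := by rw [hκ]; field_simp
  have e2 : τ = κ * Real.sin t := by
    rw [hκ]; field_simp; linarith
  have c1 := cat_cos hM p x p' g hg g0 g1 (by
    have := dist_triangle p x p'
    rw [dist_comm p x] at *; rw [dist_comm p' p]; linarith) t ⟨ht0, htD⟩
  have c2 := cat_cos hM x' x p' g hg g0 g1 (by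
    have := dist_triangle x' p' x
    rw [dist_comm p' x] at this; rw [dist_comm p' x']; linarith) t ⟨ht0, htD⟩
  have m1 : dist x (g t) = t := by
    rw [← g0, hg 0 ⟨le_rfl, hD0.le⟩ t ⟨ht0, htD⟩, zero_sub, abs_neg, abs_of_nonneg ht0]
  have m2 : dist (g t) p' = D - t := by
    conv_lhs => rw [← g1]
    rw [hg t ⟨ht0, htD⟩ D ⟨hD0.le, le_rfl⟩, abs_sub_comm, abs_of_nonneg (by linarith)]
  set m := g t
  set A := dist p m with hA
  set B := dist x' m with hB
  have hA1 : A ≤ dist x p + t := by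
    have := dist_triangle p x m
    rw [dist_comm p x, m1] at this; exact this
  have hB1 : B ≤ dist x' p' + (D - t) := by
    have := dist_triangle x' p' m
    rw [dist_comm p' m, m2] at this; exact this
  have hAB : dist x' p ≤ A + B := by
    have := dist_triangle x' m p
    rw [dist_comm m p] at this; linarith
  have hcos : Real.cos (A + B) ≤ Real.cos (dist x' p) := by
    rcases le_total (A + B) (Real.pi / 2) with h | h
    · exact Real.cos_le_cos_of_nonneg_of_le_pi dist_nonneg (by linarith) hAB
    · have h1 : Real.cos (A + B) ≤ 0 :=
        Real.cos_nonpos_of_pi_div_two_le_of_le h (by linarith)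
      have h2 : 0 ≤ Real.cos (dist x' p) := Real.cos_nonneg_of_neg_pi_div_two_le_of_le
        (by linarith [dist_nonneg (x := x') (y := p)]) hD'.le
      linarith
  rw [Real.cos_add] at hcos
  have hX : (μ * Real.cos A + ν * Real.cos B) ^ 2 ≤
      μ ^ 2 + ν ^ 2 + 2 * μ * ν * Real.cos (dist x' p) := by
    have h1 := mul_le_mul_of_nonneg_left hcos (mul_nonneg hμ hν)
    have h2 := Real.sin_sq_add_cos_sq A
    have h3 := Real.sin_sq_add_cos_sq B
    have h4 : μ ^ 2 + ν ^ 2 + 2 * μ * ν * (Real.cos A * Real.cos B - Real.sin A * Real.sin B) =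
      (μ * Real.cos A + ν * Real.cos B) ^ 2 + (μ * Real.sin A - ν * Real.sin B) ^ 2 := by
      linear_combination (-μ ^ 2) * h2 - ν ^ 2 * h3
    have h5 := sq_nonneg (μ * Real.sin A - ν * Real.sin B)
    linarith
  have hn : σ ^ 2 + τ ^ 2 + 2 * σ * τ * Real.cos D = (κ * Real.sin D) ^ 2 := by
    rw [e1, e2, Real.sin_sub]
    have h2 := Real.sin_sq_add_cos_sq t
    have h3 := Real.sin_sq_add_cos_sq D
    linear_combination (κ ^ 2 * Real.sin D ^ 2) * h2 - κ ^ 2 * Real.sin t ^ 2 * h3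
  rw [hn]
  have n1 : σ * Real.cos (dist x p) + τ * Real.cos (dist p p') ≤ κ * Real.sin D * Real.cos A := by
    rw [e1, e2]
    have := mul_le_mul_of_nonneg_left c1 hκ0.le
    rw [dist_comm p x] at this
    linarith
  have n2 : σ * Real.cos (dist x x') + τ * Real.cos (dist x' p') ≤
      κ * Real.sin D * Real.cos B := by
    rw [e1, e2]
    have := mul_le_mul_of_nonneg_left c2 hκ0.le
    rw [dist_comm x' x] at this
    linarith
  have n3 := mul_le_mul_of_nonneg_left n1 hμ
  have n4 := mul_le_mul_of_nonneg_left n2 hν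
  have n5 := sq_nonneg (μ * Real.cos A + ν * Real.cos B - κ * Real.sin D)
  clear_value A B D κ
  generalize Real.cos (dist x' p) = y1 at *
  generalize Real.cos (dist x' p') = y2 at *
  generalize Real.cos (dist x p) = y3 at *
  generalize Real.cos (dist x x') = y4 at *
  generalize Real.cos (dist p p') = y5 at *
  linarith

theorem quad_fermi {M : Type*} [MetricSpace M] (hM : CatK 1 M) (x p p' x' : M)
    (hf : dist x p < Real.pi / 2) (hf' : dist x' p' < Real.pi / 2)
    (hD : dist x p' < Real.pi / 2) (hD' : dist x' p < Real.pi / 2)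
    (hfD : dist x p ≤ dist x p') :
    Real.cos (dist x x') + Real.cos (dist x p) * Real.cos (dist x' p') * Real.cos (dist p p') ≤
      Real.sin (dist x p) * Real.sin (dist x' p') +
      Real.cos (dist x p) * Real.cos (dist x' p) + Real.cos (dist x' p') * Real.cos (dist x p') := by
  rcases (dist_nonneg (x := x) (y := p)).eq_or_lt with h | h
  · have hxp : x = p := by rw [← dist_eq_zero, ← h]
    subst hxp
    simp [dist_comm x x']
  rcases (dist_nonneg (x := x') (y := p')).eq_or_lt with h' | h'
  · have hxp : x' = p' := by rw [← dist_eq_zero, ← h']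
    subst hxp
    simp [dist_comm x' p]
    linarith
  have hpi := Real.pi_pos
  have s1 : 0 < Real.sin (dist x p) := Real.sin_pos_of_pos_of_lt_pi h (by linarith)
  have s2 : 0 < Real.sin (dist x' p') := Real.sin_pos_of_pos_of_lt_pi h' (by linarith)
  have c1 : 0 < Real.cos (dist x p) := Real.cos_pos_of_mem_Ioo ⟨by linarith, hf⟩
  have c2 : 0 < Real.cos (dist x' p') := Real.cos_pos_of_mem_Ioo ⟨by linarith, hf'⟩
  have := quad_ineq hM x p p' x' hf hf' hD hD' (by linarith)
    (Real.sin (dist x' p') * Real.cos (dist x p)) (Real.sin (dist x p)) (Real.sin (dist x' p'))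
    (Real.sin (dist x p) * Real.cos (dist x' p')) (by positivity) s1.le s2 (by positivity)
  have h2 := Real.sin_sq_add_cos_sq (dist x p)
  have h3 := Real.sin_sq_add_cos_sq (dist x' p')
  have h4 : 0 < 2 * (Real.sin (dist x p) * Real.sin (dist x' p')) := by positivity
  apply le_of_mul_le_mul_left _ h4
  generalize Real.sin (dist x p) = s at *
  generalize Real.sin (dist x' p') = s' at *
  generalize Real.cos (dist x p) = c at *
  generalize Real.cos (dist x' p') = c' at *
  have e1 : c ^ 2 = 1 - s ^ 2 := by linarith
  have e2 : c' ^ 2 = 1 - s' ^ 2 := by linarith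
  have k1 : s' ^ 2 * c ^ 2 = s' ^ 2 * (1 - s ^ 2) := by rw [e1]
  have k2 : s ^ 2 * c' ^ 2 = s ^ 2 * (1 - s' ^ 2) := by rw [e2]
  nlinarith [this, k1, k2]

theorem foot_T {M : Type*} [MetricSpace M] (hM : CatK 1 M) (T : Set M) (hT : PiTotallyConvex T)
    (x p p' : M) (hp : p ∈ T) (hp' : p' ∈ T) (h : dist x p < Real.pi / 2)
    (h' : dist x p' < Real.pi / 2) (t : ℝ) (ht : t ∈ Set.Icc 0 (dist p p')) :
    Real.sin (dist p p' - t) * Real.cos (dist x p) + Real.sin t * Real.cos (dist x p') ≤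
      Real.sin (dist p p') * Real.cos (Metric.infDist x T) := by
  have hb : dist p p' < Real.pi := by
    have := dist_triangle p x p'
    rw [dist_comm p x] at this; linarith
  have hb0 : 0 ≤ dist p p' := dist_nonneg
  obtain ⟨g, hg, g0, g1⟩ := cat_joined hM p p' hb
  have hgt : g t ∈ T := hT g (dist p p') hb0 hb hg (by rw [g0]; exact hp) (by rw [g1]; exact hp') t ht
  have c1 := cat_cos hM x p p' g hg g0 g1 (by rw [dist_comm p' x]; linarith) t ht
  refine c1.trans ?_
  have m1 : dist p (g t) = t := by
    conv_lhs => rw [← g0]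
    rw [hg 0 ⟨le_rfl, hb0⟩ t ht, zero_sub, abs_neg, abs_of_nonneg ht.1]
  have m2 : dist p' (g t) = dist p p' - t := by
    conv_lhs => rw [← g1]
    rw [hg (dist p p') ⟨hb0, le_rfl⟩ t ht, abs_of_nonneg (by linarith [ht.2])]
  have t1 := dist_triangle x p (g t)
  have t2 := dist_triangle x p' (g t)
  apply mul_le_mul_of_nonneg_left _ (Real.sin_nonneg_of_nonneg_of_le_pi hb0 hb.le)
  apply Real.cos_le_cos_of_nonneg_of_le_pi Metric.infDist_nonneg (by linarith)
  exact Metric.infDist_le_dist_of_mem hgt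

theorem foot_exists {M : Type*} [MetricSpace M] (hM : CatK 1 M) (T : Set M)
    (hT : PiTotallyConvex T) (hne : T.Nonempty) (x : M) (hf : Metric.infDist x T < Real.pi / 2) :
    ∃ p ∈ closure T, dist x p = Metric.infDist x T := by
  have := hM.1
  have hpi := Real.pi_pos
  set f := Metric.infDist x T with hfd
  have hf0 : 0 ≤ f := Metric.infDist_nonneg
  set c := Real.pi / 2 - f with hc
  have hc0 : 0 < c := by linarith
  set η : ℕ → ℝ := fun n => c * (1 / ((n : ℝ) + 1)) with hη
  have hη0 : ∀ n, 0 < η n := fun n => by simp only [hη]; positivity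
  have hηc : ∀ n, η n ≤ c := fun n => by
    simp only [hη]
    have : 1 / ((n : ℝ) + 1) ≤ 1 := by
      rw [div_le_one (by positivity)]
      have : (0 : ℝ) ≤ n := Nat.cast_nonneg n
      linarith
    nlinarith
  have hηanti : Antitone η := fun m n hmn => by
    simp only [hη]
    gcongr
  have hηlim : Tendsto η atTop (𝓝 0) := by
    have := (tendsto_one_div_add_atTop_nhds_zero_nat (𝕜 := ℝ)).const_mul c
    simpa [hη] using this
  have hex : ∀ n, ∃ p ∈ T, dist x p < f + η n := fun n =>
    (Metric.infDist_lt_iff hne).1 (by linarith [hη0 n])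
  choose P hPT hPd using hex
  have hPf : ∀ n, f ≤ dist x (P n) := fun n => Metric.infDist_le_dist_of_mem (hPT n)
  have hPpi : ∀ n, dist x (P n) < Real.pi / 2 := fun n => by linarith [hPd n, hηc n]
  have cf : 0 < Real.cos f := Real.cos_pos_of_mem_Ioo ⟨by linarith, hf⟩
  have hcau : CauchySeq P := by
    refine cauchySeq_of_le_tendsto_0 (fun N => 2 * Real.arccos (Real.cos (f + η N) / Real.cos f))
      ?_ ?_
    · intro n m N hn hm
      set b := dist (P n) (P m) with hb
      have hb0 : 0 ≤ b := dist_nonneg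
      have hbpi : b < Real.pi := by
        have := dist_triangle (P n) x (P m)
        rw [dist_comm (P n) x] at this; linarith [hPpi n, hPpi m]
      have k1 : Real.cos (f + η N) ≤ Real.cos (dist x (P n)) :=
        Real.cos_le_cos_of_nonneg_of_le_pi dist_nonneg (by linarith [hηc N])
          (by linarith [hPd n, hηanti hn])
      have k2 : Real.cos (f + η N) ≤ Real.cos (dist x (P m)) :=
        Real.cos_le_cos_of_nonneg_of_le_pi dist_nonneg (by linarith [hηc N])
          (by linarith [hPd m, hηanti hm])
      have k3 : Real.cos (f + η N) ≤ Real.cos (b / 2) * Real.cos f := by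
        rcases hb0.eq_or_lt with h | h
        · rw [← h]; simp
          exact Real.cos_le_cos_of_nonneg_of_le_pi hf0 (by linarith [hηc N])
            (by linarith [hη0 N])
        · have hs : 0 < Real.sin (b / 2) := Real.sin_pos_of_pos_of_lt_pi (by linarith) (by linarith)
          have := foot_T hM T hT x (P n) (P m) (hPT n) (hPT m) (hPpi n) (hPpi m) (b / 2)
            ⟨by linarith, by linarith⟩
          rw [← hb, ← hfd] at this
          have e1 : b - b / 2 = b / 2 := by ring
          have e2 : Real.sin b = 2 * Real.sin (b / 2) * Real.cos (b / 2) := by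
            rw [← Real.sin_two_mul]; congr 1; ring
          rw [e1, e2] at this
          apply le_of_mul_le_mul_left _ hs
          nlinarith [mul_le_mul_of_nonneg_left k1 hs.le, mul_le_mul_of_nonneg_left k2 hs.le]
      have k4 : Real.cos (f + η N) / Real.cos f ≤ Real.cos (b / 2) := by
        rwa [div_le_iff₀ cf]
      have k5 := Real.arccos_le_arccos k4
      rw [Real.arccos_cos (by linarith) (by linarith)] at k5
      linarith
    · have h1 : Tendsto (fun N => 2 * Real.arccos (Real.cos (f + η N) / Real.cos f)) atTop
          (𝓝 (2 * Real.arccos (Real.cos (f + 0) / Real.cos f))) := by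
        apply Tendsto.const_mul
        apply (Real.continuous_arccos.tendsto _).comp
        apply Tendsto.div_const
        apply (Real.continuous_cos.tendsto _).comp
        exact hηlim.const_add f
      simpa [cf.ne'] using h1
  obtain ⟨p, hp⟩ := cauchySeq_tendsto_of_complete hcau
  refine ⟨p, mem_closure_of_tendsto hp (Eventually.of_forall hPT), ?_⟩
  have hd : Tendsto (fun n => dist x (P n)) atTop (𝓝 (dist x p)) := tendsto_const_nhds.dist hp
  apply tendsto_nhds_unique hd
  have hu : Tendsto (fun n => f + η n) atTop (𝓝 f) := by simpa using hηlim.const_add f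
  exact tendsto_of_tendsto_of_tendsto_of_le_of_le tendsto_const_nhds hu hPf (fun n => (hPd n).le)

theorem foot_ineq {M : Type*} [MetricSpace M] (hM : CatK 1 M) (T : Set M)
    (hT : PiTotallyConvex T) (x p p' : M) (hf : Metric.infDist x T < Real.pi / 2)
    (hp : p ∈ closure T) (hp' : p' ∈ closure T)
    (hxp : dist x p = Metric.infDist x T) (hD : dist x p' < Real.pi / 2) :
    Real.cos (dist x p') ≤ Real.cos (dist x p) * Real.cos (dist p p') := by
  have hpi := Real.pi_pos
  rcases (dist_nonneg (x := p) (y := p')).eq_or_lt with hb0 | hb0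
  · have : p = p' := by rw [← dist_eq_zero, ← hb0]
    subst this; simp
  obtain ⟨P, hPT, hP⟩ := mem_closure_iff_seq_limit.1 hp
  obtain ⟨Q, hQT, hQ⟩ := mem_closure_iff_seq_limit.1 hp'
  have l1 : Tendsto (fun n => dist x (P n)) atTop (𝓝 (dist x p)) := tendsto_const_nhds.dist hP
  have l2 : Tendsto (fun n => dist x (Q n)) atTop (𝓝 (dist x p')) := tendsto_const_nhds.dist hQ
  have l3 : Tendsto (fun n => dist (P n) (Q n)) atTop (𝓝 (dist p p')) := hP.dist hQ
  have hbpi : dist p p' < Real.pi := by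
    have := dist_triangle p x p'
    rw [dist_comm p x] at this; linarith
  have key : ∀ t ∈ Set.Ioo 0 (dist p p'),
      Real.sin (dist p p' - t) * Real.cos (dist x p) + Real.sin t * Real.cos (dist x p') ≤
      Real.sin (dist p p') * Real.cos (dist x p) := by
    intro t ht
    rw [← hxp] at hf
    have hev : ∀ᶠ n in atTop, Real.sin (dist (P n) (Q n) - t) * Real.cos (dist x (P n)) +
        Real.sin t * Real.cos (dist x (Q n)) ≤
        Real.sin (dist (P n) (Q n)) * Real.cos (dist x p) := by
      filter_upwards [l1.eventually_lt_const hf, l2.eventually_lt_const hD,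
        l3.eventually_const_lt ht.2] with n h1 h2 h3
      rw [hxp]
      exact foot_T hM T hT x (P n) (Q n) (hPT n) (hQT n) h1 h2 t ⟨ht.1.le, h3.le⟩
    refine le_of_tendsto_of_tendsto ?_ ?_ hev
    · apply Tendsto.add
      · exact ((Real.continuous_sin.tendsto _).comp (l3.sub_const t)).mul
          ((Real.continuous_cos.tendsto _).comp l1)
      · exact ((Real.continuous_cos.tendsto _).comp l2).const_mul _
    · exact ((Real.continuous_sin.tendsto _).comp l3).mul_const _
  -- divide by sin (t/2) and let t → 0
  have key2 : ∀ t ∈ Set.Ioo 0 (dist p p'),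
      Real.cos (t / 2) * Real.cos (dist x p') ≤
      Real.cos (dist x p) * Real.cos (dist p p' - t / 2) := by
    intro t ht
    have h1 := key t ht
    have hs : 0 < Real.sin (t / 2) :=
      Real.sin_pos_of_pos_of_lt_pi (by linarith [ht.1]) (by linarith [ht.2])
    have e1 : Real.sin t = 2 * Real.sin (t / 2) * Real.cos (t / 2) := by
      rw [← Real.sin_two_mul]; congr 1; ring
    have e2 : Real.sin (dist p p') - Real.sin (dist p p' - t) =
        2 * Real.sin (t / 2) * Real.cos (dist p p' - t / 2) := by
      rw [Real.sin_sub_sin]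
      congr 2
      · congr 1; ring
      · ring_nf
    apply le_of_mul_le_mul_left _ hs
    have e3 : Real.sin (dist p p' - t) = Real.sin (dist p p') -
        2 * Real.sin (t / 2) * Real.cos (dist p p' - t / 2) := by linarith
    rw [e1, e3] at h1
    nlinarith
  have hmem : ∀ᶠ t in 𝓝[>] (0 : ℝ), t ∈ Set.Ioo 0 (dist p p') := Ioo_mem_nhdsGT hb0
  have lim1 : Tendsto (fun t : ℝ => Real.cos (t / 2) * Real.cos (dist x p')) (𝓝[>] 0)
      (𝓝 (Real.cos (0 / 2) * Real.cos (dist x p'))) :=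
    tendsto_nhdsWithin_of_tendsto_nhds (Continuous.tendsto (by fun_prop) 0)
  have lim2 : Tendsto (fun t : ℝ => Real.cos (dist x p) * Real.cos (dist p p' - t / 2)) (𝓝[>] 0)
      (𝓝 (Real.cos (dist x p) * Real.cos (dist p p' - 0 / 2))) :=
    tendsto_nhdsWithin_of_tendsto_nhds (Continuous.tendsto (by fun_prop) 0)
  have := le_of_tendsto_of_tendsto lim1 lim2 (hmem.mono key2)
  simpa using this

/-- `z` is the push of `x` into the `ρ`-tube -/
def IsPush {M : Type*} [MetricSpace M] (T : Set M) (ρ : ℝ) (x z : M) : Prop :=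
  Metric.infDist z T ≤ ρ ∧ (Metric.infDist x T ≤ ρ → z = x) ∧
  (ρ ≤ Metric.infDist x T → ∃ p ∈ closure T, ∃ α β : ℝ, dist x p = Metric.infDist x T ∧
    0 ≤ α ∧ 0 ≤ β ∧ α * Real.sin (dist x p) = Real.sin ρ ∧
    β + α * Real.cos (dist x p) = Real.cos ρ ∧ dist x z ≤ dist x p - ρ ∧
    ∀ w, dist w p + dist p x + dist x w < 2 * Real.pi →
      α * Real.cos (dist w x) + β * Real.cos (dist w p) ≤ Real.cos (dist w z))

theorem push_exists {M : Type*} [MetricSpace M] (hM : CatK 1 M) (T : Set M)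
    (hT : PiTotallyConvex T) (hne : T.Nonempty) (ρ : ℝ) (hρ : 0 ≤ ρ) (x : M)
    (hf : Metric.infDist x T < Real.pi / 2) : ∃ z, IsPush T ρ x z := by
  have hpi := Real.pi_pos
  rcases le_or_gt (Metric.infDist x T) ρ with h | h
  · refine ⟨x, h, fun _ => rfl, fun h' => ?_⟩
    obtain ⟨p, hp, hxp⟩ := foot_exists hM T hT hne x hf
    have e : dist x p = ρ := by rw [hxp]; linarith
    refine ⟨p, hp, 1, 0, hxp, zero_le_one, le_rfl, ?_, ?_, ?_, ?_⟩
    · rw [e, one_mul]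
    · rw [e]; ring
    · rw [e]; simp
    · intro w _; simp
  · obtain ⟨p, hp, hxp⟩ := foot_exists hM T hT hne x hf
    have hd : dist p x = Metric.infDist x T := by rw [dist_comm, hxp]
    obtain ⟨g, hg, g0, g1⟩ := cat_joined hM p x (by linarith)
    have hρm : ρ ∈ Set.Icc 0 (dist p x) := ⟨hρ, by linarith⟩
    have m1 : dist (g ρ) p = ρ := by
      conv_lhs => rw [← g0]
      rw [hg ρ hρm 0 ⟨le_rfl, dist_nonneg⟩, sub_zero, abs_of_nonneg hρ]
    have m2 : dist x (g ρ) = dist p x - ρ := by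
      conv_lhs => rw [← g1]
      rw [hg (dist p x) ⟨dist_nonneg, le_rfl⟩ ρ hρm, abs_of_nonneg (by linarith)]
    have hs : 0 < Real.sin (dist p x) := Real.sin_pos_of_pos_of_lt_pi (by linarith) (by linarith)
    refine ⟨g ρ, ?_, fun h' => absurd h' (not_le.2 h), fun _ => ⟨p, hp,
      Real.sin ρ / Real.sin (dist p x), Real.sin (dist p x - ρ) / Real.sin (dist p x), hxp,
      ?_, ?_, ?_, ?_, ?_, ?_⟩⟩
    · rw [← Metric.infDist_closure]
      exact (Metric.infDist_le_dist_of_mem hp).trans m1.le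
    · exact div_nonneg (Real.sin_nonneg_of_nonneg_of_le_pi hρ (by linarith)) hs.le
    · exact div_nonneg (Real.sin_nonneg_of_nonneg_of_le_pi (by linarith) (by linarith)) hs.le
    · rw [dist_comm x p]; field_simp
    · rw [dist_comm x p, Real.sin_sub]; field_simp; ring
    · rw [m2, dist_comm]
    · intro w hw
      have := cat_cos hM w p x g hg g0 g1 hw ρ hρm
      rw [div_mul_eq_mul_div, div_mul_eq_mul_div, ← add_div, div_le_iff₀ hs]
      linarith

theorem push_alg (α α' β β' c c' s s' sr cr ch CD CD' cb : ℝ)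
    (hα : 0 ≤ α) (hα' : 0 ≤ α') (hβ : 0 ≤ β) (hβ' : 0 ≤ β') (hc : 0 < c) (hc' : 0 < c')
    (h1 : α * s = sr) (h1' : α' * s' = sr) (h2 : β + α * c = cr) (h2' : β' + α' * c' = cr)
    (hq : ch + c * c' * cb ≤ s * s' + c * CD' + c' * CD)
    (hD : CD ≤ c * cb) (hD' : CD' ≤ c' * cb) :
    sr ^ 2 * (c * c') + cr ^ 2 * (ch - s * s') ≤
      (c * c') * (α * α' * ch + α * β' * CD + β * α' * CD' + β * β' * cb) := by
  have e1 : sr ^ 2 = (α * s) * (α' * s') := by rw [h1, h1']; ring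
  have e2 : cr ^ 2 = (β + α * c) * (β' + α' * c') := by rw [h2, h2']; ring
  rw [e1, e2]
  -- ω - u, ω - u' ≥ 0
  have w1 : 0 ≤ s * s' + c * c' * cb - ch - c' * (c * cb - CD) := by nlinarith
  have w2 : 0 ≤ s * s' + c * c' * cb - ch - c * (c' * cb - CD') := by nlinarith
  have w0 : 0 ≤ s * s' + c * c' * cb - ch := by
    nlinarith [mul_nonneg hc'.le (sub_nonneg.2 hD)]
  have p0 := mul_nonneg (mul_nonneg hβ hβ') w0
  have p1 := mul_nonneg (mul_nonneg (mul_nonneg hα hc.le) hβ') w1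
  have p2 := mul_nonneg (mul_nonneg (mul_nonneg hβ hα') hc'.le) w2
  nlinarith [p0, p1, p2]

theorem push_step {M : Type*} [MetricSpace M] (hM : CatK 1 M) (T : Set M)
    (hT : PiTotallyConvex T) (ρ : ℝ) (hρ : 0 ≤ ρ) (x x' z z' : M)
    (hz : IsPush T ρ x z) (hz' : IsPush T ρ x' z')
    (hf : ρ ≤ Metric.infDist x T) (hf' : ρ ≤ Metric.infDist x' T)
    (hfh : Metric.infDist x T + dist x x' < Real.pi / 2)
    (hfh' : Metric.infDist x' T + dist x x' < Real.pi / 2) :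
    Real.cos ρ ^ 2 * (Real.cos (dist x x') -
      Real.sin (Metric.infDist x T) * Real.sin (Metric.infDist x' T)) ≤
    (Real.cos (Metric.infDist x T) * Real.cos (Metric.infDist x' T)) *
      (Real.cos (dist z z') - Real.sin ρ ^ 2) := by
  have hpi := Real.pi_pos
  have hh : 0 ≤ dist x x' := dist_nonneg
  obtain ⟨p, hp, α, β, hxp, hα, hβ, h1, h2, h3, h4⟩ := hz.2.2 hf
  obtain ⟨p', hp', α', β', hxp', hα', hβ', h1', h2', h3', h4'⟩ := hz'.2.2 hf'
  have hD : dist x p' < Real.pi / 2 := by linarith [dist_triangle x x' p']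
  have hD' : dist x' p < Real.pi / 2 := by
    have := dist_triangle x' x p; rw [dist_comm x' x] at this; linarith
  have hfD : dist x p ≤ dist x p' := by
    rw [hxp, ← Metric.infDist_closure]; exact Metric.infDist_le_dist_of_mem hp'
  have q := quad_fermi hM x p p' x' (by linarith) (by linarith) hD hD' hfD
  have f1 := foot_ineq hM T hT x p p' (by linarith) hp hp' hxp hD
  have f2 := foot_ineq hM T hT x' p' p (by linarith) hp' hp hxp' hD'
  rw [dist_comm p' p] at f2
  have c1 : 0 < Real.cos (dist x p) :=
    Real.cos_pos_of_mem_Ioo ⟨by linarith [dist_nonneg (x := x) (y := p)], by linarith⟩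
  have c2 : 0 < Real.cos (dist x' p') :=
    Real.cos_pos_of_mem_Ioo ⟨by linarith [dist_nonneg (x := x') (y := p')], by linarith⟩
  have A := push_alg α α' β β' _ _ _ _ _ _ _ _ _ _ hα hα' hβ hβ' c1 c2 h1 h1' h2 h2' q f1 f2
  have b1 := h4 z' (by
    have t1 := dist_triangle z' x p
    have t2 := dist_triangle z' x' x
    rw [dist_comm x' x, dist_comm z' x'] at t2
    rw [dist_comm p x, dist_comm x z']; linarith)
  have b2 := h4' x (by
    have t2 := dist_triangle x p' x'
    rw [dist_comm p' x'] at *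
    rw [dist_comm x' x]; linarith)
  have b3 := h4' p (by
    have t2 := dist_triangle p x' p'
    rw [dist_comm p' x', dist_comm p x'] at *
    linarith)
  rw [dist_comm z' x, dist_comm z' p, dist_comm z' z] at b1
  rw [dist_comm p x'] at b3
  have B : α * α' * Real.cos (dist x x') + α * β' * Real.cos (dist x p') +
      β * α' * Real.cos (dist x' p) + β * β' * Real.cos (dist p p') ≤ Real.cos (dist z z') := by
    have := mul_le_mul_of_nonneg_left b2 hα
    have := mul_le_mul_of_nonneg_left b3 hβ
    linarith
  have C := mul_le_mul_of_nonneg_left B (mul_pos c1 c2).le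
  rw [← hxp, ← hxp']
  linarith

theorem d_bound (ρ κ f f' h d : ℝ) (hcf : 0 < Real.cos f) (hcf' : 0 < Real.cos f')
    (hcos : Real.cos ρ ^ 2 * (Real.cos h - Real.sin f * Real.sin f') ≤
      (Real.cos f * Real.cos f') * (Real.cos d - Real.sin ρ ^ 2))
    (hK : Real.cos ρ ^ 2 ≤ (1 + κ * ((f - ρ) + (f' - ρ))) * (Real.cos f * Real.cos f'))
    (hS0 : 0 ≤ κ * ((f - ρ) + (f' - ρ))) (hS1 : κ * ((f - ρ) + (f' - ρ)) ≤ 1)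
    (h0 : 0 < h) (h1 : h ≤ 1 / 10) (hΔ : |f' - f| ≤ h) (d0 : 0 ≤ d) (d1 : d ≤ 1 / 2) :
    2 * h * d ≤ 2 * h ^ 2 + κ * ((f - ρ) + (f' - ρ)) * h ^ 2 - (f' - f) ^ 2 + 2 * h ^ 4 := by
  set q := κ * ((f - ρ) + (f' - ρ)) with hq
  have hpi := Real.pi_gt_three
  have e1 : Real.cos (f' - f) = Real.cos f * Real.cos f' + Real.sin f * Real.sin f' := by
    rw [Real.cos_sub]; ring
  have hch : Real.cos h ≤ Real.cos (f' - f) := by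
    rw [← Real.cos_abs (f' - f)]
    exact Real.cos_le_cos_of_nonneg_of_le_pi (abs_nonneg _) (by linarith) hΔ
  have k1 : 1 - Real.cos d ≤ (1 + q) * (Real.cos (f' - f) - Real.cos h) := by
    have hpos : 0 < Real.cos f * Real.cos f' := mul_pos hcf hcf'
    apply le_of_mul_le_mul_left _ hpos
    have h3 := mul_le_mul_of_nonneg_right hK (sub_nonneg.2 hch)
    have h4 := Real.sin_sq_add_cos_sq ρ
    have h5 : Real.sin ρ ^ 2 = 1 - Real.cos ρ ^ 2 := by linarith
    rw [h5] at hcos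
    have h6 : Real.sin f * Real.sin f' = Real.cos (f' - f) - Real.cos f * Real.cos f' := by
      linarith
    rw [h6] at hcos
    nlinarith
  have k2 := Real.one_sub_sq_div_two_le_cos (x := h)
  have k3 := (abs_le.1 (Real.cos_bound (x := f' - f) (by linarith))).2
  have k4 := (abs_le.1 (Real.cos_bound (x := d) (by rw [abs_of_nonneg d0]; linarith))).2
  rw [abs_of_nonneg d0] at k4
  have k5 : |f' - f| ^ 4 ≤ h ^ 4 := by gcongr
  have k6 : (f' - f) ^ 2 ≤ h ^ 2 := by
    rw [← sq_abs]; gcongr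
  generalize hΔd : f' - f = Δ at *
  have k7 : Real.cos Δ - Real.cos h ≤ (h ^ 2 - Δ ^ 2) / 2 + h ^ 4 * (5 / 96) := by linarith
  have k8 : d ^ 2 / 2 - d ^ 4 * (5 / 96) ≤ (1 + q) * ((h ^ 2 - Δ ^ 2) / 2 + h ^ 4 * (5 / 96)) := by
    have := mul_le_mul_of_nonneg_left k7 (by linarith : 0 ≤ 1 + q)
    linarith
  have hh4 : h ^ 4 ≤ h ^ 2 / 100 := by
    have a : h ^ 2 ≤ 1 / 100 := by nlinarith
    have := mul_le_mul_of_nonneg_left a (sq_nonneg h)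
    linarith
  have k9 : (1 + q) * ((h ^ 2 - Δ ^ 2) / 2 + h ^ 4 * (5 / 96)) ≤
      (1 + q) * h ^ 2 / 2 - Δ ^ 2 / 2 + h ^ 4 * (5 / 48) := by
    have a1 : 0 ≤ q * Δ ^ 2 := mul_nonneg hS0 (sq_nonneg _)
    have a2 : q * h ^ 4 ≤ 1 * h ^ 4 := mul_le_mul_of_nonneg_right hS1 (by positivity)
    linarith
  have hd4 : d ^ 4 ≤ d ^ 2 / 4 := by
    have a : d ^ 2 ≤ 1 / 4 := by nlinarith
    have := mul_le_mul_of_nonneg_left a (sq_nonneg d)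
    linarith
  have hd2 : d ^ 2 ≤ 3 * h ^ 2 := by
    have a1 : q * h ^ 2 ≤ 1 * h ^ 2 := mul_le_mul_of_nonneg_right hS1 (by positivity)
    linarith [sq_nonneg Δ, sq_nonneg h]
  have hd44 : d ^ 4 ≤ 9 * h ^ 4 := by
    have := mul_le_mul hd2 hd2 (sq_nonneg d) (by positivity)
    linarith
  have hh40 : 0 ≤ h ^ 4 := by positivity
  linarith [sq_nonneg (d - h)]

theorem calib (κ r t t' e e' d : ℝ) (ht : t < t')
    (hd : 2 * (t' - t) * d ≤ 2 * (t' - t) ^ 2 + κ * (e + e') * (t' - t) ^ 2 - (e' - e) ^ 2 +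
      2 * (t' - t) ^ 4) :
    d ≤ (t' - e' * (κ * (r / 2 - t')) - κ ^ 2 * (r / 2 - t') ^ 3 / 6) -
      (t - e * (κ * (r / 2 - t)) - κ ^ 2 * (r / 2 - t) ^ 3 / 6) + (t' - t) ^ 3 := by
  obtain ⟨h, rfl⟩ : ∃ h, t' = t + h := ⟨t' - t, by ring⟩
  have h0 : 0 < h := by linarith
  rw [add_sub_cancel_left] at *
  apply le_of_mul_le_mul_left _ (by positivity : 0 < 2 * h)
  refine hd.trans ?_
  have a1 := sq_nonneg (h * (κ * (r / 2 - t - h / 2)) - (e' - e))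
  have a2 : 0 ≤ κ ^ 2 * h ^ 4 := by positivity
  nlinarith [a1, a2]

theorem calib0 (κ r t t' : ℝ) (ht : t ≤ t') :
    t' - t ≤ (t' - 0 * (κ * (r / 2 - t')) - κ ^ 2 * (r / 2 - t') ^ 3 / 6) -
      (t - 0 * (κ * (r / 2 - t)) - κ ^ 2 * (r / 2 - t) ^ 3 / 6) := by
  obtain ⟨h, rfl⟩ : ∃ h, t' = t + h := ⟨t' - t, by ring⟩
  have h0 : 0 ≤ h := by linarith
  have a2 : (r / 2 - (t + h)) ^ 3 ≤ (r / 2 - t) ^ 3 := by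
    exact (Odd.strictMono_pow (by decide : Odd 3)).monotone (by linarith)
  nlinarith [mul_le_mul_of_nonneg_left a2 (sq_nonneg κ)]

theorem halving {M : Type*} [MetricSpace M] (z : ℝ → M) (G : ℝ → ℝ) (r : ℝ)
    (H : ∀ s t, 0 ≤ s → s ≤ t → t ≤ r → dist (z s) (z t) ≤ G t - G s + (t - s) ^ 3) :
    ∀ s t, 0 ≤ s → s ≤ t → t ≤ r → dist (z s) (z t) ≤ G t - G s := by
  have A : ∀ k : ℕ, ∀ s t, 0 ≤ s → s ≤ t → t ≤ r →
      dist (z s) (z t) ≤ G t - G s + (t - s) ^ 3 * (1 / 4) ^ k := by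
    intro k
    induction k with
    | zero => simpa using H
    | succ k ih =>
      intro s t hs hst ht
      have h1 := ih s ((s + t) / 2) hs (by linarith) (by linarith)
      have h2 := ih ((s + t) / 2) t (by linarith) (by linarith) ht
      have h3 := dist_triangle (z s) (z ((s + t) / 2)) (z t)
      have e : ((s + t) / 2 - s) ^ 3 * (1 / 4 : ℝ) ^ k + (t - (s + t) / 2) ^ 3 * (1 / 4) ^ k =
        (t - s) ^ 3 * (1 / 4) ^ (k + 1) := by rw [pow_succ]; ring
      linarith
  intro s t hs hst ht
  have l : Tendsto (fun k : ℕ => G t - G s + (t - s) ^ 3 * (1 / 4 : ℝ) ^ k) atTop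
      (𝓝 (G t - G s + (t - s) ^ 3 * 0)) :=
    ((tendsto_pow_atTop_nhds_zero_of_lt_one (by norm_num) (by norm_num)).const_mul _).const_add _
  have := ge_of_tendsto' l (fun k => A k s t hs hst ht)
  simpa using this

theorem curve_len {M : Type*} [MetricSpace M] (N : Set M) (z : ℝ → M) (G : ℝ → ℝ) (r : ℝ)
    (hr : 0 ≤ r) (hG : ContinuousOn G (Set.Icc 0 r)) (hN : ∀ t ∈ Set.Icc 0 r, z t ∈ N)
    (H : ∀ s t, 0 ≤ s → s ≤ t → t ≤ r → dist (z s) (z t) ≤ G t - G s) :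
    setIntrinsicEDist N (z 0) (z r) ≤ ENNReal.ofReal (G r - G 0) := by
  have hm : ∀ t ∈ Set.Icc (0 : ℝ) 1, r * t ∈ Set.Icc 0 r := fun t ht =>
    ⟨mul_nonneg hr ht.1, by nlinarith [ht.2]⟩
  have hmono : MonotoneOn (fun t => G (r * t)) (Set.Icc 0 1) := by
    intro s hs t ht hst
    have := H (r * s) (r * t) (hm s hs).1 (mul_le_mul_of_nonneg_left hst hr) (hm t ht).2
    have := dist_nonneg (x := z (r * s)) (y := z (r * t))
    simp only
    linarith
  have habs : ∀ s ∈ Set.Icc 0 r, ∀ t ∈ Set.Icc 0 r, dist (z s) (z t) ≤ dist (G s) (G t) := by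
    intro s hs t ht
    rw [Real.dist_eq]
    rcases le_total s t with h | h
    · have := H s t hs.1 h ht.2
      rw [abs_sub_comm]; exact this.trans (le_abs_self _)
    · have := H t s ht.1 h hs.2
      rw [dist_comm]; exact this.trans (le_abs_self _)
  have hzc : ContinuousOn z (Set.Icc 0 r) := by
    rw [Metric.continuousOn_iff] at hG ⊢
    intro b hb ε hε
    obtain ⟨δ, hδ, h⟩ := hG b hb ε hε
    exact ⟨δ, hδ, fun a ha hab => (habs a ha b hb).trans_lt (h a ha hab)⟩
  have hvar : eVariationOn (fun t => z (r * t)) (Set.Icc 0 1) ≤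
      eVariationOn (fun t => G (r * t)) (Set.Icc 0 1) := by
    unfold eVariationOn
    apply iSup_mono
    rintro ⟨n, u, hu, hus⟩
    apply Finset.sum_le_sum
    intro i _
    rw [edist_dist, edist_dist]
    exact ENNReal.ofReal_le_ofReal (habs _ (hm _ (hus _)) _ (hm _ (hus _)))
  unfold setIntrinsicEDist
  have hfin : eVariationOn (fun t => G (r * t)) (Set.Icc 0 1) ≤ ENNReal.ofReal (G r - G 0) := by
    have := hmono.eVariationOn_eq (a := 0) (b := 1) (by simp) (by simp)
    rw [Set.inter_self] at this
    simp [this]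
  refine (iInf₂_le (fun t => z (r * t)) ⟨?_, ?_, ?_, ?_⟩).trans (hvar.trans hfin)
  · exact hzc.comp (by fun_prop) hm
  · exact fun t ht => hN _ (hm t ht)
  · simp
  · simp

theorem edist_le_intrinsic {M : Type*} [MetricSpace M] (N : Set M) (x y : M) :
    edist x y ≤ setIntrinsicEDist N x y := by
  unfold setIntrinsicEDist
  refine le_iInf₂ fun γ h => ?_
  rw [← h.2.2.1, ← h.2.2.2]
  exact eVariationOn.edist_le _ (by simp) (by simp)

/-- Bound for the metric factor -/
theorem factor_bound (ρ κ e e' δ : ℝ) (hρ : 0 ≤ ρ) (hρ2 : ρ < Real.pi / 2) 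
    (he : 0 ≤ e) (he' : 0 ≤ e') (heδ : e ≤ δ) (heδ' : e' ≤ δ) (hδ1 : δ ≤ 1)
    (hκ : 0 < κ) (hκδ : Real.tan ρ + δ / 2 + (Real.tan ρ + 1) * κ * (2 * δ) ≤ κ)
    (hκδ1 : (Real.tan ρ + 1) * δ ≤ 1) :
    Real.cos ρ ^ 2 ≤ (1 + κ * (e + e')) * (Real.cos (ρ + e) * Real.cos (ρ + e')) := by
  have hpi := Real.pi_pos
  have cρ : 0 < Real.cos ρ := Real.cos_pos_of_mem_Ioo ⟨by linarith, hρ2⟩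
  have k0 : 0 ≤ Real.tan ρ := Real.tan_nonneg_of_nonneg_of_le_pi_div_two hρ hρ2.le
  set k := Real.tan ρ with hk
  have hsin : Real.sin ρ = k * Real.cos ρ := by rw [hk, Real.tan_mul_cos cρ.ne']
  set k1 := k + δ / 2 with hk1
  have hk10 : 0 ≤ k1 := by linarith
  have A : ∀ e, 0 ≤ e → e ≤ δ → Real.cos ρ * (1 - k1 * e) ≤ Real.cos (ρ + e) := by
    intro e h0 h1
    rw [Real.cos_add, hsin]
    have h2 := Real.one_sub_sq_div_two_le_cos (x := e)
    have h3 : k * Real.sin e ≤ k * e := mul_le_mul_of_nonneg_left (Real.sin_le h0) k0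
    have h4 : e ^ 2 / 2 ≤ δ / 2 * e := by nlinarith
    have : 1 - k1 * e ≤ Real.cos e - k * Real.sin e := by rw [hk1]; nlinarith
    nlinarith [mul_le_mul_of_nonneg_left this cρ.le]
  have hk1le : k1 ≤ k + 1 := by linarith
  have p1 : 0 ≤ 1 - k1 * e := by nlinarith
  have p2 : 0 ≤ 1 - k1 * e' := by nlinarith
  have B : Real.cos ρ ^ 2 * ((1 - k1 * e) * (1 - k1 * e')) ≤
      Real.cos (ρ + e) * Real.cos (ρ + e') := by
    have := mul_le_mul (A e he heδ) (A e' he' heδ') (by positivity)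
      ((mul_nonneg cρ.le p1).trans (A e he heδ))
    nlinarith
  have C : 1 ≤ (1 + κ * (e + e')) * ((1 - k1 * e) * (1 - k1 * e')) := by
    have c1 : 1 - k1 * (e + e') ≤ (1 - k1 * e) * (1 - k1 * e') := by
      nlinarith [mul_nonneg (mul_nonneg hk10 he) (mul_nonneg hk10 he')]
    have hS : 0 ≤ e + e' := by linarith
    have c2 := mul_le_mul_of_nonneg_left c1 (by positivity : 0 ≤ 1 + κ * (e + e'))
    have c3 : k1 * κ * (e + e') ≤ (k + 1) * κ * (2 * δ) := by
      apply mul_le_mul (mul_le_mul_of_nonneg_right hk1le hκ.le) (by linarith) hS (by positivity)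
    have c4 : 0 ≤ (κ - k1 - k1 * κ * (e + e')) * (e + e') := mul_nonneg (by linarith) hS
    nlinarith
  have D := mul_le_mul_of_nonneg_left B (by positivity : 0 ≤ 1 + κ * (e + e'))
  nlinarith [mul_le_mul_of_nonneg_left C (sq_nonneg (Real.cos ρ))]

theorem tube_core {M : Type*} [MetricSpace M] (hM : CatK 1 M) (T : Set M)
    (hT : PiTotallyConvex T) (hne : T.Nonempty) (ρ κ δ : ℝ) (hρ : 0 ≤ ρ)
    (hρ2 : ρ < Real.pi / 2) (hδ : ρ + 3 * δ < Real.pi / 2) (hδ1 : δ ≤ 1 / 10)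
    (hκ : 0 < κ) (hκδ : Real.tan ρ + δ / 2 + (Real.tan ρ + 1) * κ * (2 * δ) ≤ κ)
    (hκδ1 : (Real.tan ρ + 1) * δ ≤ 1) (hκδ2 : κ * (2 * δ) ≤ 1) (x y : M)
    (hx : Metric.infDist x T ≤ ρ) (hy : Metric.infDist y T ≤ ρ) (hxy : dist x y ≤ δ) :
    setIntrinsicEDist {x : M | Metric.infDist x T ≤ ρ} x y ≤
      ENNReal.ofReal (dist x y + κ ^ 2 / 24 * dist x y ^ 3) := by
  have hpi := Real.pi_gt_three
  obtain ⟨g, hg, g0, g1⟩ := cat_joined hM x y (by linarith)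
  set r := dist x y with hr
  have hr0 : 0 ≤ r := dist_nonneg
  set φ : ℝ → ℝ := fun t => Metric.infDist (g t) T with hφ
  have hdist : ∀ s t, 0 ≤ s → s ≤ t → t ≤ r → dist (g s) (g t) = t - s := by
    intro s t h0 h1 h2
    rw [hg s ⟨h0, by linarith⟩ t ⟨by linarith, h2⟩, abs_sub_comm, abs_of_nonneg (by linarith)]
  have hφlip : ∀ s t, 0 ≤ s → s ≤ t → t ≤ r → |φ t - φ s| ≤ t - s := by
    intro s t h0 h1 h2
    have a1 := Metric.infDist_le_infDist_add_dist (s := T) (x := g t) (y := g s)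
    have a2 := Metric.infDist_le_infDist_add_dist (s := T) (x := g s) (y := g t)
    rw [dist_comm (g t), hdist s t h0 h1 h2] at a1
    rw [hdist s t h0 h1 h2] at a2
    rw [abs_le]; constructor <;> simp only [hφ] <;> linarith
  have hφ0 : φ 0 ≤ ρ := by simp only [hφ, g0]; exact hx
  have hφr : φ r ≤ ρ := by simp only [hφ, g1]; exact hy
  have hφle : ∀ t ∈ Set.Icc 0 r, φ t ≤ ρ + δ := by
    intro t ht
    have := (abs_le.1 (hφlip 0 t le_rfl ht.1 ht.2)).2
    linarith [ht.2]
  have hgc : ContinuousOn g (Set.Icc 0 r) := by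
    rw [Metric.continuousOn_iff]
    intro b hb ε hε
    exact ⟨ε, hε, fun a ha hab => by rw [hg a ha b hb]; exact hab⟩
  have hφc : ContinuousOn φ (Set.Icc 0 r) :=
    (Metric.continuous_infDist_pt T).comp_continuousOn hgc
  have hex : ∀ t, ∃ z, t ∈ Set.Icc 0 r → IsPush T ρ (g t) z := by
    intro t
    by_cases ht : t ∈ Set.Icc 0 r
    · have h1 := hφle t ht
      obtain ⟨z, hz⟩ := push_exists hM T hT hne ρ hρ (g t)
        (by simp only [hφ] at h1; linarith)
      exact ⟨z, fun _ => hz⟩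
    · exact ⟨g t, fun h => absurd h ht⟩
  choose z hz using hex
  set e : ℝ → ℝ := fun t => max (φ t - ρ) 0 with he
  set G : ℝ → ℝ := fun t => t - e t * (κ * (r / 2 - t)) - κ ^ 2 * (r / 2 - t) ^ 3 / 6 with hG
  have e_lo : ∀ t, φ t ≤ ρ → e t = 0 := fun t h => max_eq_right (by linarith)
  have e_hi : ∀ t, ρ ≤ φ t → e t = φ t - ρ := fun t h => max_eq_left (by linarith)
  have P2 : ∀ s t, 0 ≤ s → s ≤ t → t ≤ r → φ s ≤ ρ → φ t ≤ ρ →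
      dist (z s) (z t) ≤ G t - G s + (t - s) ^ 3 := by
    intro s t h0 h1 h2 hs ht
    have z1 : z s = g s := (hz s ⟨h0, h1.trans h2⟩).2.1 hs
    have z2 : z t = g t := (hz t ⟨h0.trans h1, h2⟩).2.1 ht
    rw [z1, z2, hdist s t h0 h1 h2]
    simp only [hG]
    rw [e_lo s hs, e_lo t ht]
    have c := calib0 κ r s t h1
    have : 0 ≤ (t - s) ^ 3 := pow_nonneg (by linarith) 3
    linarith
  have P1 : ∀ s t, 0 ≤ s → s ≤ t → t ≤ r → ρ ≤ φ s → ρ ≤ φ t →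
      dist (z s) (z t) ≤ G t - G s + (t - s) ^ 3 := by
    intro s t h0 h1 h2 hs ht
    rcases h1.eq_or_lt with h | h
    · subst h; simp
    have ms : s ∈ Set.Icc 0 r := ⟨h0, h1.trans h2⟩
    have mt : t ∈ Set.Icc 0 r := ⟨h0.trans h1, h2⟩
    have es := hφle s ms
    have et := hφle t mt
    have hd := hdist s t h0 h1 h2
    have st := push_step hM T hT ρ hρ (g s) (g t) (z s) (z t) (hz s ms) (hz t mt) hs ht
      (by rw [hd]; simp only [hφ] at es; linarith)
      (by rw [hd]; simp only [hφ] at et; linarith)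
    rw [hd] at st
    obtain ⟨p, _, _, _, hp, _, _, _, _, hp3, _⟩ := (hz s ms).2.2 hs
    obtain ⟨p', _, _, _, hp', _, _, _, _, hp3', _⟩ := (hz t mt).2.2 ht
    have fb := factor_bound ρ κ (φ s - ρ) (φ t - ρ) δ hρ hρ2 (by linarith) (by linarith)
      (by linarith) (by linarith) (by linarith) hκ hκδ hκδ1
    rw [add_sub_cancel, add_sub_cancel] at fb
    have dz : dist (z s) (z t) ≤ 1 / 2 := by
      have t1 := dist_triangle (z s) (g s) (z t)
      have t2 := dist_triangle (g s) (g t) (z t)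
      rw [dist_comm (z s) (g s)] at t1
      simp only [hφ] at es et
      linarith
    have db := d_bound ρ κ (φ s) (φ t) (t - s) (dist (z s) (z t))
      (Real.cos_pos_of_mem_Ioo ⟨by linarith, by linarith⟩)
      (Real.cos_pos_of_mem_Ioo ⟨by linarith, by linarith⟩) st fb
      (mul_nonneg hκ.le (by linarith))
      ((mul_le_mul_of_nonneg_left (by linarith) hκ.le).trans hκδ2) (by linarith) (by linarith)
      (hφlip s t h0 h1 h2) dist_nonneg dz
    have c := calib κ r s t (φ s - ρ) (φ t - ρ) (dist (z s) (z t)) h (by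
      rw [sub_sub_sub_cancel_right]; exact db)
    simp only [hG]
    rw [e_hi s hs, e_hi t ht]
    exact c
  have cube : ∀ s u t : ℝ, s ≤ u → u ≤ t → (u - s) ^ 3 + (t - u) ^ 3 ≤ (t - s) ^ 3 := by
    intro s u t h1 h2
    have : 0 ≤ 3 * (u - s) * (t - u) * (t - s) :=
      mul_nonneg (mul_nonneg (by linarith) (by linarith)) (by linarith)
    nlinarith
  have H0 : ∀ s t, 0 ≤ s → s ≤ t → t ≤ r →
      dist (z s) (z t) ≤ G t - G s + (t - s) ^ 3 := by
    intro s t h0 h1 h2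
    have hc' : ContinuousOn φ (Set.Icc s t) := hφc.mono (Set.Icc_subset_Icc h0 h2)
    rcases le_total (φ s) ρ with a | a <;> rcases le_total (φ t) ρ with b | b
    · exact P2 s t h0 h1 h2 a b
    · obtain ⟨u, ⟨hu1, hu2⟩, hu⟩ := intermediate_value_Icc h1 hc' ⟨a, b⟩
      have A := P2 s u h0 hu1 (hu2.trans h2) a hu.le
      have B := P1 u t (h0.trans hu1) hu2 h2 hu.ge b
      linarith [dist_triangle (z s) (z u) (z t), cube s u t hu1 hu2]
    · obtain ⟨u, ⟨hu1, hu2⟩, hu⟩ := intermediate_value_Icc' h1 hc' ⟨b, a⟩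
      have A := P1 s u h0 hu1 (hu2.trans h2) a hu.ge
      have B := P2 u t (h0.trans hu1) hu2 h2 hu.le b
      linarith [dist_triangle (z s) (z u) (z t), cube s u t hu1 hu2]
    · exact P1 s t h0 h1 h2 a b
  have H := halving z G r H0
  have hGc : ContinuousOn G (Set.Icc 0 r) := by
    have hec : ContinuousOn e (Set.Icc 0 r) := (hφc.sub continuousOn_const).sup continuousOn_const
    simp only [hG]
    fun_prop
  have fin := curve_len {x : M | Metric.infDist x T ≤ ρ} z G r hr0 hGc
    (fun t ht => (hz t ht).1) H
  rw [(hz 0 ⟨le_rfl, hr0⟩).2.1 hφ0, (hz r ⟨hr0, le_rfl⟩).2.1 hφr, g0, g1] at fin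
  have eG : G r - G 0 = r + κ ^ 2 / 24 * r ^ 3 := by
    simp only [hG]
    rw [e_lo 0 hφ0, e_lo r hφr]
    ring
  rwa [eG] at fin

theorem tube_nonempty {M : Type*} [MetricSpace M] (hM : CatK 1 M) (T : Set M)
    (hT : PiTotallyConvex T) (hne : T.Nonempty) (ρ : ℝ) (hρ : 0 ≤ ρ) (hρ2 : ρ < Real.pi / 2) :
    SetExtrinsicCurvLE (Real.tan ρ) {x : M | Metric.infDist x T ≤ ρ} := by
  have := hM.1
  refine ⟨(isClosed_le (Metric.continuous_infDist_pt T) continuous_const).isComplete, ?_⟩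
  intro ε hε
  have k0 : 0 ≤ Real.tan ρ := Real.tan_nonneg_of_nonneg_of_le_pi_div_two hρ hρ2.le
  set k := Real.tan ρ with hk
  set ε' := min 1 (24 * ε / (2 * k + 1)) with hε'
  have hε'0 : 0 < ε' := lt_min one_pos (by positivity)
  have hε'1 : ε' ≤ 1 := min_le_left _ _
  have hε'2 : ε' * (2 * k + 1) ≤ 24 * ε := by
    rw [← le_div_iff₀ (by positivity)]; exact min_le_right _ _
  set κ := k + ε' with hκ
  have hκ0 : 0 < κ := by positivity
  set δ := min (min ((Real.pi / 2 - ρ) / 4) (1 / 10))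
    (min (ε' / (1 + (k + 1) * κ * 2)) (min (1 / (k + 1)) (1 / (2 * κ)))) with hδ
  have d1 : δ ≤ (Real.pi / 2 - ρ) / 4 := (min_le_left _ _).trans (min_le_left _ _)
  have d2 : δ ≤ 1 / 10 := (min_le_left _ _).trans (min_le_right _ _)
  have d3 : δ ≤ ε' / (1 + (k + 1) * κ * 2) := (min_le_right _ _).trans (min_le_left _ _)
  have d4 : δ ≤ 1 / (k + 1) :=
    (min_le_right _ _).trans ((min_le_right _ _).trans (min_le_left _ _))
  have d5 : δ ≤ 1 / (2 * κ) :=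
    (min_le_right _ _).trans ((min_le_right _ _).trans (min_le_right _ _))
  have hδ0 : 0 < δ := by
    refine lt_min (lt_min (by linarith) (by norm_num)) (lt_min ?_ (lt_min ?_ ?_)) <;> positivity
  rw [le_div_iff₀ (by positivity)] at d3 d4 d5
  clear_value δ
  refine ⟨δ, hδ0, fun x hx y hy hs => ?_⟩
  have hr : dist x y < δ := by
    have := (edist_le_intrinsic _ x y).trans_lt hs
    rwa [edist_dist, ENNReal.ofReal_lt_ofReal_iff hδ0] at this
  have core := tube_core hM T hT hne ρ κ δ hρ hρ2 (by linarith) d2 hκ0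
    (by rw [← hk]; nlinarith) (by rw [← hk]; linarith) (by linarith) x y hx hy hr.le
  have hr0 : 0 ≤ dist x y := dist_nonneg
  have h2 := ENNReal.toReal_mono ENNReal.ofReal_ne_top core
  rw [ENNReal.toReal_ofReal (by positivity)] at h2
  have h3 : κ ^ 2 ≤ k ^ 2 + 24 * ε := by rw [hκ]; nlinarith
  have h4 : κ ^ 2 / 24 * dist x y ^ 3 ≤ (k ^ 2 + 24 * ε) / 24 * dist x y ^ 3 := by gcongr
  linarith

/-- **Proposition 6.1.**  Let `T` be a `π`-totally-convex set in a CAT(1) space `M`, and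
let `N` be the set of points at distance `≤ ρ` from `T`, where `ρ < π/2`.  Then `N` is a
subset of extrinsic curvature `≤ tan ρ` in `M`: for pairs of points of `N` with
sufficiently small induced intrinsic distance `s` and extrinsic distance `r`,
`s - r ≤ ((tan ρ)²/24) r³ + o(r³)` uniformly. -/
theorem tube_extrinsic_curvature {M : Type*} [MetricSpace M] (hM : CatK 1 M)
    (T : Set M) (hT : PiTotallyConvex T) (ρ : ℝ) (hρ : ρ < Real.pi / 2) :
    SetExtrinsicCurvLE (Real.tan ρ) {x : M | Metric.infDist x T ≤ ρ} := by
  rcases lt_or_ge ρ 0 with h | h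
  · have he : {x : M | Metric.infDist x T ≤ ρ} = ∅ := by
      ext x
      simp only [Set.mem_ofPred_eq, Set.mem_empty_iff_false, iff_false, not_le]
      exact h.trans_le Metric.infDist_nonneg
    rw [he]
    have := hM.1
    refine ⟨isClosed_empty.isComplete, fun ε hε => ⟨1, one_pos, fun x hx => absurd hx ?_⟩⟩
    exact Set.notMem_empty x
  · rcases T.eq_empty_or_nonempty with hT0 | hT0
    · rcases isEmpty_or_nonempty M with hM0 | hM0
      · have := hM.1
        refine ⟨(isClosed_le (Metric.continuous_infDist_pt T) continuous_const).isComplete,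
          fun ε hε => ⟨1, one_pos, fun x => (hM0.false x).elim⟩⟩
      · have e : {x : M | Metric.infDist x T ≤ ρ} =
            {x : M | Metric.infDist x (Set.univ : Set M) ≤ ρ} := by
          ext x
          simp [hT0, Metric.infDist_zero_of_mem (Set.mem_univ x)]
        rw [e]
        exact tube_nonempty hM Set.univ (fun _ _ _ _ _ _ _ _ _ => Set.mem_univ _)
          Set.univ_nonempty ρ h hρ
    · exact tube_nonempty hM T hT hT0 ρ h hρ

end
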